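/- Let c assign to each unordered pair of distinct indices from {1,…,11} a color in {1,…,7} as follows (this is the pattern of unique orthogonal coordinates of the 7-qubit UPB of size 11 constructed in the paper): color 1 on {1,3},{1,4},{2,3},{2,4},{5,7},{5,8},{6,7},{6,8},{9,11},{10,11}; color 2 on {1,5},{1,6},{4,5},{4,6},{2,11},{3,11},{7,8},{7,9},{8,10},{9,10}; color 3 on {1,9},{1,10},{3,9},{3,10},{6,9},{6,10},{2,7},{2,8},{4,7},{4,8},{5,11}; color 4 on {1,11},{2,5},{3,6},{3,8},{4,9},{7,10}; color 5 on {1,2},{3,7},{4,10},{5,9},{6,11},{8,11}; color 6 on {1,7},{2,6},{2,10},{3,5},{4,11},{8,9}; color 7 on {1,8},{2,9},{3,4},{5,6},{5,10},{7,11}. Then for all distinct colors m ≠ n in {1,…,7} and every partition of {1,…,11} into two nonempty disjoint sets P and Q, there exist i ∈ P and k ∈ Q with c{i,k} ∈ {m,n}, and there exist i' ∈ P and k' ∈ Q with c{i',k'} ∉ {m,n}. (This is the combinatorial content of the local indistinguishability of the size-11 7-qubit UPB across every bipartition into two qubits {m,n} and the remaining five qubits: the UPB cannot be split into two mutually orthogonal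 nonempty subsets either on systems {m,n} or on their complement.) -/

import Mathlib

/-- Auxiliary table: the color of the (sorted) pair of rows, following the pattern of
unique orthogonal coordinates of the 7-qubit UPB of size 11. -/
def pairColorAux : ℕ → ℕ → ℕ
  | 1, 3 => 1 | 1, 4 => 1 | 2, 3 => 1 | 2, 4 => 1 | 5, 7 => 1
  | 5, 8 => 1 | 6, 7 => 1 | 6, 8 => 1 | 9, 11 => 1 | 10, 11 => 1
  | 1, 5 => 2 | 1, 6 => 2 | 4, 5 => 2 | 4, 6 => 2 | 2, 11 => 2
  | 3, 11 => 2 | 7, 8 => 2 | 7, 9 => 2 | 8, 10 => 2 | 9, 10 => 2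
  | 1, 9 => 3 | 1, 10 => 3 | 3, 9 => 3 | 3, 10 => 3 | 6, 9 => 3
  | 6, 10 => 3 | 2, 7 => 3 | 2, 8 => 3 | 4, 7 => 3 | 4, 8 => 3 | 5, 11 => 3
  | 1, 11 => 4 | 2, 5 => 4 | 3, 6 => 4 | 3, 8 => 4 | 4, 9 => 4 | 7, 10 => 4
  | 1, 2 => 5 | 3, 7 => 5 | 4, 10 => 5 | 5, 9 => 5 | 6, 11 => 5 | 8, 11 => 5
  | 1, 7 => 6 | 2, 6 => 6 | 2, 10 => 6 | 3, 5 => 6 | 4, 11 => 6 | 8, 9 => 6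
  | 1, 8 => 7 | 2, 9 => 7 | 3, 4 => 7 | 5, 6 => 7 | 5, 10 => 7 | 7, 11 => 7
  | _, _ => 0

/-- The edge coloring of the complete graph on `{1,…,11}` by colors in `{1,…,7}`,
as a symmetric function of unordered pairs. -/
def pairColor (i k : ℕ) : ℕ := pairColorAux (min i k) (max i k)

/-- The vertices of `V` that lie in `S` or are `r`-related to a member of `S`. -/
def expandWithin (V : Finset ℕ) (r : ℕ → ℕ → Prop) [DecidableRel r] (S : Finset ℕ) : Finset ℕ :=
  V.filter fun k => k ∈ S ∨ ∃ i ∈ S, r i k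

theorem iterate_expandWithin_subset {V P Q : Finset ℕ} {r : ℕ → ℕ → Prop} [DecidableRel r]
    (hV : P ∪ Q = V) (hr : ∀ i ∈ P, ∀ k ∈ Q, ¬ r i k) (t : ℕ) {S : Finset ℕ} (hS : S ⊆ P) :
    (expandWithin V r)^[t] S ⊆ P := by
  induction t generalizing S with
  | zero => exact hS
  | succ t ih =>
    refine ih fun k hk => ?_
    obtain ⟨hkV, hkS | ⟨i, hi, hik⟩⟩ := Finset.mem_filter.mp hk
    · exact hS hkS
    · rw [← hV, Finset.mem_union] at hkV
      exact hkV.resolve_right fun hkQ => hr i (hS hi) k hkQ hik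

/-- If every vertex of `V` is reached from `v`, then `r` relates some vertex of `P` to some
vertex of `Q` in every partition of `V` into nonempty parts `P` and `Q`. -/
theorem exists_cross_of_iterate_expandWithin {V P Q : Finset ℕ} {r : ℕ → ℕ → Prop}
    [DecidableRel r] (hsymm : ∀ i k, r i k → r k i) {v t : ℕ} (hv : v ∈ V)
    (hreach : V ⊆ (expandWithin V r)^[t] {v}) (hV : P ∪ Q = V) (hdisj : Disjoint P Q)
    (hP : P.Nonempty) (hQ : Q.Nonempty) : ∃ i ∈ P, ∃ k ∈ Q, r i k := by
  by_contra! hr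
  rw [← hV, Finset.mem_union] at hv
  rcases hv with hv | hv
  · obtain ⟨q, hq⟩ := hQ
    have hqP := iterate_expandWithin_subset hV hr t (Finset.singleton_subset_iff.mpr hv)
      (hreach (hV ▸ Finset.mem_union_right P hq))
    exact Finset.disjoint_left.mp hdisj hqP hq
  · obtain ⟨p, hp⟩ := hP
    have hpQ := iterate_expandWithin_subset (Finset.union_comm Q P ▸ hV)
      (fun i hi k hk hik => hr k hk i hi (hsymm i k hik)) t (Finset.singleton_subset_iff.mpr hv)
      (hreach (hV ▸ Finset.mem_union_left Q hp))
    exact Finset.disjoint_left.mp hdisj hp hpQ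

theorem pairColor_comm (i k : ℕ) : pairColor i k = pairColor k i := by
  rw [pairColor, pairColor, min_comm, max_comm]

theorem two_color_reachable : ∀ m ∈ Finset.Icc 1 7, ∀ n ∈ Finset.Icc 1 7, m ≠ n →
    Finset.Icc 1 11 ⊆ (expandWithin (Finset.Icc 1 11)
      fun i k => pairColor i k = m ∨ pairColor i k = n)^[5] {1} := by
  decide +kernel

theorem compl_two_color_reachable : ∀ m ∈ Finset.Icc 1 7, ∀ n ∈ Finset.Icc 1 7, m ≠ n →
    Finset.Icc 1 11 ⊆ (expandWithin (Finset.Icc 1 11)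
      fun i k => pairColor i k ≠ m ∧ pairColor i k ≠ n)^[5] {1} := by
  decide +kernel

/-- For any two distinct colors `m ≠ n` and any partition of `{1,…,11}` into two
nonempty parts `P`, `Q`, some cross pair has color in `{m, n}` and some cross pair has
color outside `{m, n}`: the combinatorial content of the local indistinguishability of
the size-11 7-qubit UPB across every 2-vs-5 qubit bipartition. -/
theorem coloring_no_bipartite_split (m n : ℕ) (hm : m ∈ Finset.Icc 1 7)
    (hn : n ∈ Finset.Icc 1 7) (hmn : m ≠ n) (P Q : Finset ℕ)
    (hPQ : P ∪ Q = Finset.Icc 1 11) (hdisj : Disjoint P Q)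
    (hP : P.Nonempty) (hQ : Q.Nonempty) :
    (∃ i ∈ P, ∃ k ∈ Q, pairColor i k = m ∨ pairColor i k = n) ∧
    (∃ i ∈ P, ∃ k ∈ Q, pairColor i k ≠ m ∧ pairColor i k ≠ n) := by
  have h1 : 1 ∈ Finset.Icc 1 11 := by simp
  exact ⟨exists_cross_of_iterate_expandWithin (fun i k h => by rwa [pairColor_comm k i]) h1
      (two_color_reachable m hm n hn hmn) hPQ hdisj hP hQ,
    exists_cross_of_iterate_expandWithin (fun i k h => by rwa [pairColor_comm k i]) h1
      (compl_two_color_reachable m hm n hn hmn) hPQ hdisj hP hQ⟩
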